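/- arXiv:2411.05471 — 4 statements merged into one kernel-verified Lean document; each statement's English description precedes it below -/
import Mathlib

section
/- The polynomial Liouville function over 𝔽₂ satisfies ℓ(2n) = -ℓ(n) for all n ≥ 1, where ℓ(n) = λ(F_n) and F_n(X) = ∑_{j=1}^r n_j X^{j-1} for the binary digits n_j of n (so that F_{2n} = X·F_n and λ(X·F) = -λ(F)). Consequently, for every r ≥ 1, any Boolean function B : 𝔽₂^r → 𝔽₂ satisfying ℓ(∑_{j=1}^r n_j 2^{j-1}) = (-1)^{B(n_1,…,n_r)} for all (n_1,…,n_r) ∈ 𝔽₂^r \ {(0,…,0)} satisfies deg(B) ≥ r - 1 and spr(B) ≥ ⌊2^r/3⌋. -/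
open scoped BigOperators

/-- Algebraic normal form coefficient `a_I` of the Boolean function `B` in `r` variables,
obtained by Möbius inversion over `𝔽₂`. -/
def anf {r : ℕ} (B : (Fin r → ZMod 2) → ZMod 2) (I : Finset (Fin r)) : ZMod 2 :=
  ∑ J ∈ I.powerset, B (fun i => if i ∈ J then 1 else 0)

/-- Sparsity (algebraic thickness): the number of nonzero ANF coefficients. -/
def sparsity {r : ℕ} (B : (Fin r → ZMod 2) → ZMod 2) : ℕ :=
  (Finset.univ.filter fun I : Finset (Fin r) => anf B I ≠ 0).card

/-- Algebraic degree: the maximal `|I|` with `a_I = 1` (and `0` for the zero function). -/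
def algDeg {r : ℕ} (B : (Fin r → ZMod 2) → ZMod 2) : ℕ :=
  (Finset.univ.filter fun I : Finset (Fin r) => anf B I ≠ 0).sup Finset.card

/-- The integer `∑_{j=1}^r n_j 2^{j-1}` corresponding to the bit vector `(n_1,…,n_r)`. -/
def bitVal {r : ℕ} (x : Fin r → ZMod 2) : ℕ :=
  ∑ j : Fin r, (x j).val * 2 ^ (j : ℕ)


/-- The polynomial Liouville function over `𝔽₂`: `λ(F) = (-1)^{∑ a_j}` where
`F = ∏ I_j^{a_j}` is the factorization into distinct monic irreducibles (so the
exponent is the number of irreducible factors counted with multiplicity);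
`λ` of a nonzero constant is `1`. -/
noncomputable def polyLiouville (F : Polynomial (ZMod 2)) : ℤ :=
  (-1) ^ (Multiset.card (UniqueFactorizationMonoid.normalizedFactors F))

/-- The polynomial `F_n(X) = ∑_j n_j X^{j-1}` attached to the binary digits of `n`. -/
noncomputable def Fpoly (n : ℕ) : Polynomial (ZMod 2) :=
  ∑ j ∈ Finset.range n, if n.testBit j then Polynomial.X ^ j else 0

/-- The arithmetic function `ℓ(n) = λ(F_n)` attached to the polynomial Liouville
function over `𝔽₂`. -/
noncomputable def polyLiouvilleSeq (n : ℕ) : ℤ := polyLiouville (Fpoly n)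

open Polynomial in
theorem coeff_Fpoly (n k : ℕ) : (Fpoly n).coeff k = if n.testBit k then 1 else 0 := by
  have hterm : ∀ j, (if n.testBit j then (X : (ZMod 2)[X]) ^ j else 0).coeff k =
      if k = j then (if n.testBit k then 1 else 0) else 0 := by
    intro j
    by_cases hkj : k = j
    · subst hkj
      by_cases h : n.testBit k <;> simp [h]
    · split_ifs <;> simp [coeff_X_pow, hkj]
  rw [Fpoly, finsetSum_coeff, Finset.sum_congr rfl fun j _ => hterm j, Finset.sum_ite_eq]
  split_ifs with hk hb hb
  · rfl
  · rfl
  · exact absurd (Finset.mem_range.2 (k.lt_two_pow_self.trans_le (Nat.ge_two_pow_of_testBit hb))) hk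
  · rfl

theorem Fpoly_ne_zero {n : ℕ} (hn : n ≠ 0) : Fpoly n ≠ 0 := by
  obtain ⟨k, hk⟩ := Nat.exists_testBit_of_ne_zero hn
  intro h
  have := coeff_Fpoly n k
  simp [h, hk] at this

theorem Fpoly_two_mul (n : ℕ) : Fpoly (2 * n) = Polynomial.X * Fpoly n := by
  ext k
  cases k with
  | zero => simp [coeff_Fpoly]
  | succ k => simp [coeff_Fpoly, Nat.testBit_succ]

theorem polyLiouville_X_mul {F : Polynomial (ZMod 2)} (hF : F ≠ 0) :
    polyLiouville (Polynomial.X * F) = -polyLiouville F := by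
  rw [polyLiouville, polyLiouville,
    UniqueFactorizationMonoid.normalizedFactors_mul Polynomial.X_ne_zero hF,
    UniqueFactorizationMonoid.normalizedFactors_irreducible Polynomial.irreducible_X]
  simp [pow_add]

theorem polyLiouvilleSeq_two_mul {n : ℕ} (hn : n ≠ 0) :
    polyLiouvilleSeq (2 * n) = -polyLiouvilleSeq n := by
  rw [polyLiouvilleSeq, Fpoly_two_mul, polyLiouville_X_mul (Fpoly_ne_zero hn), polyLiouvilleSeq]

/-- If a predicate flips under doubling below `2 ^ r`, it holds for at least a third of the
numbers below `2 ^ r`. -/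
theorem two_pow_div_three_le_card (r : ℕ) (p : ℕ → Prop) [DecidablePred p]
    (hp : ∀ n, n ≠ 0 → 2 * n < 2 ^ r → (p (2 * n) ↔ ¬ p n)) :
    2 ^ r / 3 ≤ ((Finset.range (2 ^ r)).filter p).card := by
  induction r using Nat.strong_induction_on generalizing p with
  | _ r ih =>
    obtain _ | _ | r := r
    · simp
    · simp
    · have hpow : 2 ^ (r + 1 + 1) = 4 * 2 ^ r := by ring
      rw [hpow] at hp ⊢
      have hfour : 2 ^ r / 3 ≤ ((Finset.range (2 ^ r)).filter fun n => p (4 * n)).card := by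
        refine ih r (by omega) (fun n => p (4 * n)) fun n hn hlt => ?_
        have h := hp (4 * n) (by omega) (by omega)
        rwa [show 2 * (4 * n) = 4 * (2 * n) by ring] at h
      let A := ((Finset.range (2 ^ r)).filter fun n => p (4 * n)).image (4 * ·)
      let C := (Finset.range (2 ^ r)).image
        fun m => if p (2 * m + 1) then 2 * m + 1 else 2 * (2 * m + 1)
      have hA : A.card = ((Finset.range (2 ^ r)).filter fun n => p (4 * n)).card :=
        Finset.card_image_of_injective _ fun a b h => by simpa using h
      have hC : C.card = 2 ^ r := by
        rw [Finset.card_image_of_injective, Finset.card_range]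
        intro a b h
        dsimp only at h
        split_ifs at h <;> omega
      have hdisj : Disjoint A C := by
        rw [Finset.disjoint_left]
        intro n hnA hnC
        obtain ⟨a, -, rfl⟩ := Finset.mem_image.1 hnA
        obtain ⟨m, -, hm⟩ := Finset.mem_image.1 hnC
        split_ifs at hm <;> omega
      have hsub : A ∪ C ⊆ (Finset.range (4 * 2 ^ r)).filter p := by
        intro n hn
        rw [Finset.mem_filter, Finset.mem_range]
        rcases Finset.mem_union.1 hn with h | h
        · obtain ⟨a, ha, rfl⟩ := Finset.mem_image.1 h
          rw [Finset.mem_filter, Finset.mem_range] at ha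
          exact ⟨by omega, ha.2⟩
        · obtain ⟨m, hm, rfl⟩ := Finset.mem_image.1 h
          rw [Finset.mem_range] at hm
          split_ifs with hodd
          · exact ⟨by omega, hodd⟩
          · exact ⟨by omega, (hp _ (by omega) (by omega)).2 hodd⟩
      have hle := Finset.card_le_card hsub
      rw [Finset.card_union_of_disjoint hdisj, hA, hC] at hle
      omega

theorem anf_map {k r : ℕ} (B : (Fin r → ZMod 2) → ZMod 2) (e : Fin k ↪ Fin r)
    (I : Finset (Fin k)) :
    anf B (I.map e) = ∑ J ∈ I.powerset, B fun i => if i ∈ J.map e then 1 else 0 := by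
  have h : (I.map e).powerset = I.powerset.map (Finset.mapEmbedding e).toEmbedding := by
    ext S
    simp only [Finset.mem_powerset, Finset.mem_map, RelEmbedding.coe_toEmbedding,
      Finset.mapEmbedding_apply]
    rw [Finset.subset_map_iff]
    exact exists_congr fun _ => and_congr_right fun _ => eq_comm
  rw [anf, h, Finset.sum_map]
  rfl

theorem bitVal_map_succ {k : ℕ} (J : Finset (Fin k)) :
    bitVal (fun i : Fin (k + 1) => if i ∈ J.map (Fin.succEmb k) then 1 else 0) =
      2 * bitVal (fun i : Fin (k + 1) => if i ∈ J.map Fin.castSuccEmb then 1 else 0) := by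
  have hzero : (0 : Fin (k + 1)) ∉ J.map (Fin.succEmb k) := by simp [Fin.succ_ne_zero]
  have hlast : Fin.last k ∉ J.map Fin.castSuccEmb := by simp [Fin.castSucc_ne_last]
  rw [bitVal, bitVal, Fin.sum_univ_succ, Fin.sum_univ_castSucc, if_neg hzero, if_neg hlast]
  simp only [ZMod.val_zero, zero_mul, zero_add, add_zero, Finset.mul_sum]
  refine Finset.sum_congr rfl fun i _ => ?_
  have hs : i.succ ∈ J.map (Fin.succEmb k) ↔ i ∈ J := by simp
  have hc : i.castSucc ∈ J.map Fin.castSuccEmb ↔ i ∈ J := by simp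
  simp only [hs, hc, Fin.val_succ, Fin.val_castSucc]
  ring

theorem bitVal_ne_zero {r : ℕ} {x : Fin r → ZMod 2} (hx : x ≠ 0) : bitVal x ≠ 0 := by
  contrapose! hx
  ext i
  have h := (Finset.sum_eq_zero_iff.1 hx) i (Finset.mem_univ i)
  simpa using h

theorem eq_add_one_of_neg_one_pow_eq_neg {a b : ZMod 2}
    (h : (-1 : ℤ) ^ a.val = -(-1) ^ b.val) : a = b + 1 := by
  revert a b
  decide

section Representing

variable {k : ℕ} {B : (Fin (k + 1) → ZMod 2) → ZMod 2}

theorem apply_map_succ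
    (hB : ∀ x, x ≠ 0 → polyLiouvilleSeq (bitVal x) = (-1) ^ (B x).val)
    {J : Finset (Fin k)} (hJ : J.Nonempty) :
    B (fun i => if i ∈ J.map (Fin.succEmb k) then 1 else 0) =
      B (fun i => if i ∈ J.map Fin.castSuccEmb then 1 else 0) + 1 := by
  obtain ⟨j, hj⟩ := hJ
  have hne : ∀ e : Fin k ↪ Fin (k + 1),
      (fun i => if i ∈ J.map e then (1 : ZMod 2) else 0) ≠ 0 := fun e h => by
    have := congrFun h (e j)
    simp [hj] at this
  apply eq_add_one_of_neg_one_pow_eq_neg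
  rw [← hB _ (hne _), ← hB _ (hne _), bitVal_map_succ,
    polyLiouvilleSeq_two_mul (bitVal_ne_zero (hne _))]

theorem anf_map_succ
    (hB : ∀ x, x ≠ 0 → polyLiouvilleSeq (bitVal x) = (-1) ^ (B x).val)
    {I : Finset (Fin k)} (hI : I.Nonempty) :
    anf B (I.map (Fin.succEmb k)) = anf B (I.map Fin.castSuccEmb) + 1 := by
  have hmem := Finset.empty_mem_powerset I
  rw [anf_map, anf_map, ← Finset.add_sum_erase _ _ hmem, ← Finset.add_sum_erase _ _ hmem,
    Finset.sum_congr rfl fun J hJ => apply_map_succ hB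
      (Finset.nonempty_iff_ne_empty.2 (Finset.ne_of_mem_erase hJ)),
    Finset.sum_add_distrib, Finset.sum_const, Finset.card_erase_of_mem hmem,
    Finset.card_powerset, add_assoc]
  have hcard : ((2 ^ I.card - 1 : ℕ) : ZMod 2) = 1 := by
    rw [Nat.cast_sub Nat.one_le_two_pow, Nat.cast_pow, show ((2 : ℕ) : ZMod 2) = 0 from rfl,
      zero_pow hI.card_pos.ne']
    decide
  rw [nsmul_one, hcard]
  congr! 3

theorem anf_map_succ_ne_zero_iff
    (hB : ∀ x, x ≠ 0 → polyLiouvilleSeq (bitVal x) = (-1) ^ (B x).val)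
    {I : Finset (Fin k)} (hI : I.Nonempty) :
    anf B (I.map (Fin.succEmb k)) ≠ 0 ↔ ¬ anf B (I.map Fin.castSuccEmb) ≠ 0 := by
  rw [anf_map_succ hB hI]
  generalize anf B _ = a
  revert a
  decide

theorem le_algDeg (hB : ∀ x, x ≠ 0 → polyLiouvilleSeq (bitVal x) = (-1) ^ (B x).val) :
    k ≤ algDeg B := by
  obtain rfl | hk := Nat.eq_zero_or_pos k
  · exact Nat.zero_le _
  have key : ∀ e : Fin k ↪ Fin (k + 1), anf B (Finset.univ.map e) ≠ 0 → k ≤ algDeg B := by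
    intro e he
    have := Finset.le_sup (f := Finset.card)
      ((Finset.mem_filter (p := fun I => anf B I ≠ 0)).2 ⟨Finset.mem_univ (Finset.univ.map e), he⟩)
    simpa [algDeg] using this
  have hI : (Finset.univ : Finset (Fin k)).Nonempty := ⟨⟨0, hk⟩, Finset.mem_univ _⟩
  by_cases h : anf B (Finset.univ.map Fin.castSuccEmb) ≠ 0
  · exact key _ h
  · exact key _ ((anf_map_succ_ne_zero_iff hB hI).2 h)

end Representing

/-- The positions below `r` of the binary digits `1` of `n`. -/
def bitFinset (r n : ℕ) : Finset (Fin r) := Finset.univ.filter fun i => n.testBit i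

theorem mem_bitFinset {r n : ℕ} {i : Fin r} : i ∈ bitFinset r n ↔ n.testBit i := by
  simp [bitFinset]

theorem bitFinset_injOn (r : ℕ) : Set.InjOn (bitFinset r) (Finset.range (2 ^ r)) := by
  intro m hm n hn h
  rw [Finset.mem_coe, Finset.mem_range] at hm hn
  refine Nat.eq_of_testBit_eq fun i => ?_
  by_cases hi : i < r
  · have := congrArg (fun S : Finset (Fin r) => (⟨i, hi⟩ : Fin r) ∈ S) h
    simpa only [mem_bitFinset, eq_iff_iff, Bool.coe_iff_coe] using this
  · have hle : 2 ^ r ≤ 2 ^ i := Nat.pow_le_pow_right two_pos (not_lt.1 hi)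
    rw [Nat.testBit_lt_two_pow (hm.trans_le hle), Nat.testBit_lt_two_pow (hn.trans_le hle)]

theorem bitFinset_nonempty {k n : ℕ} (hn : n ≠ 0) (hlt : n < 2 ^ k) :
    (bitFinset k n).Nonempty := by
  rw [Finset.nonempty_iff_ne_empty]
  intro h
  refine hn (bitFinset_injOn k (by simpa using hlt) (by simp) (h.trans ?_))
  ext i
  simp [mem_bitFinset]

theorem bitFinset_succ_of_lt {k n : ℕ} (hlt : n < 2 ^ k) :
    bitFinset (k + 1) n = (bitFinset k n).map Fin.castSuccEmb := by
  ext i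
  induction i using Fin.lastCases with
  | last => simp [mem_bitFinset, Nat.testBit_lt_two_pow hlt, Fin.castSucc_ne_last]
  | cast i => simp [mem_bitFinset]

theorem bitFinset_two_mul (k n : ℕ) :
    bitFinset (k + 1) (2 * n) = (bitFinset k n).map (Fin.succEmb k) := by
  ext i
  induction i using Fin.cases with
  | zero => simp [mem_bitFinset, Fin.succ_ne_zero]
  | succ i => simp [mem_bitFinset, Nat.testBit_succ]

theorem two_pow_div_three_le_sparsity {k : ℕ} {B : (Fin (k + 1) → ZMod 2) → ZMod 2}
    (hB : ∀ x, x ≠ 0 → polyLiouvilleSeq (bitVal x) = (-1) ^ (B x).val) :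
    2 ^ (k + 1) / 3 ≤ sparsity B := by
  refine (two_pow_div_three_le_card (k + 1) (fun n => anf B (bitFinset (k + 1) n) ≠ 0)
    fun n hn hlt => ?_).trans ?_
  · have hlt' : n < 2 ^ k := by
      rw [pow_succ] at hlt
      omega
    rw [bitFinset_two_mul, bitFinset_succ_of_lt hlt']
    exact anf_map_succ_ne_zero_iff hB (bitFinset_nonempty hn hlt')
  · refine Finset.card_le_card_of_injOn (bitFinset (k + 1)) (fun n hn => ?_)
      ((bitFinset_injOn (k + 1)).mono ?_)
    · simpa using (Finset.mem_filter.1 hn).2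
    · exact_mod_cast Finset.filter_subset _ _

theorem stmt6 :
    (∀ n : ℕ, 1 ≤ n → polyLiouvilleSeq (2 * n) = - polyLiouvilleSeq n) ∧
      ∀ r : ℕ, 1 ≤ r → ∀ B : (Fin r → ZMod 2) → ZMod 2,
        (∀ x : Fin r → ZMod 2, x ≠ 0 →
          polyLiouvilleSeq (bitVal x) = (-1) ^ (B x).val) →
        r - 1 ≤ algDeg B ∧ 2 ^ r / 3 ≤ sparsity B := by
  refine ⟨fun n hn => polyLiouvilleSeq_two_mul (Nat.one_le_iff_ne_zero.1 hn), ?_⟩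
  intro r hr B hB
  obtain ⟨k, rfl⟩ := Nat.exists_eq_add_of_le' hr
  exact ⟨le_algDeg hB, two_pow_div_three_le_sparsity hB⟩
end

section
/- For every r ≥ 1, the average algebraic degree over all Boolean functions in r variables satisfies (1/2^{2^r}) ∑_B deg(B) ≥ r - 1/2 - (r-1)/2^{r+1} ≥ r - 5/8, where the sum is over all 2^{2^r} Boolean functions B : 𝔽₂^r → 𝔽₂. -/
open scoped BigOperators

theorem anf_injective (r : ℕ) :
    Function.Injective (anf : ((Fin r → ZMod 2) → ZMod 2) → Finset (Fin r) → ZMod 2) := by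
  intro B C h
  have key : ∀ I : Finset (Fin r),
      B (fun i => if i ∈ I then 1 else 0) = C (fun i => if i ∈ I then 1 else 0) := by
    intro I
    induction I using Finset.strongInduction with
    | H I ih =>
      have hI := congrFun h I
      unfold anf at hI
      rw [← Finset.sum_erase_add _ _ (Finset.mem_powerset_self I),
        ← Finset.sum_erase_add _ _ (Finset.mem_powerset_self I)] at hI
      rw [Finset.sum_congr rfl fun J hJ => ih J ?_] at hI
      · exact add_left_cancel hI
      · rw [Finset.mem_erase, Finset.mem_powerset] at hJ
        exact Finset.ssubset_iff_subset_ne.2 ⟨hJ.2, hJ.1⟩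
  funext x
  have hx : x = fun i => if i ∈ Finset.univ.filter (fun i => x i = 1) then 1 else 0 := by
    funext i
    have h2 : ∀ a : ZMod 2, a = if a = 1 then 1 else 0 := by decide
    simpa using h2 (x i)
  rw [hx]
  exact key _

theorem anf_bijective (r : ℕ) :
    Function.Bijective (anf : ((Fin r → ZMod 2) → ZMod 2) → Finset (Fin r) → ZMod 2) :=
  (Fintype.bijective_iff_injective_and_card _).2 ⟨anf_injective r, by simp [ZMod.card]⟩

/-- Vanishing on `S` imposes `S.card` independent conditions on a function with values in `𝔽₂`. -/
theorem card_vanishing_mul_two_pow {α : Type*} [Fintype α] [DecidableEq α] (S : Finset α) :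
    (Finset.univ.filter fun f : α → ZMod 2 => ∀ a ∈ S, f a = 0).card * 2 ^ S.card
      = 2 ^ Fintype.card α := by
  have h : (Finset.univ.filter fun f : α → ZMod 2 => ∀ a ∈ S, f a = 0)
      = Fintype.piFinset fun a => if a ∈ S then {0} else Finset.univ := by
    ext f
    simp only [Finset.mem_filter, Finset.mem_univ, true_and, Fintype.mem_piFinset]
    refine forall_congr' fun a => ?_
    by_cases ha : a ∈ S <;> simp [ha]
  have hp : ∏ a : α, (if a ∈ S then 2 else 1) = 2 ^ S.card := by
    simp
  rw [h, Fintype.card_piFinset, ← hp, ← Finset.prod_mul_distrib]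
  rw [Finset.prod_congr rfl (g := fun _ => 2)]
  · simp
  · intro a _
    by_cases ha : a ∈ S <;> simp [ha, ZMod.card]

/-- The Boolean functions whose ANF coefficients vanish on `S` form a fraction `2⁻¹ ^ S.card`
of all Boolean functions. -/
theorem card_anf_vanishing {r : ℕ} (S : Finset (Finset (Fin r))) :
    ((Finset.univ.filter fun B : (Fin r → ZMod 2) → ZMod 2 => ∀ I ∈ S, anf B I = 0).card : ℚ)
      = 2 ^ (2 ^ r) / 2 ^ S.card := by
  have h : (Finset.univ.filter fun B : (Fin r → ZMod 2) → ZMod 2 => ∀ I ∈ S, anf B I = 0).card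
      = (Finset.univ.filter fun f : Finset (Fin r) → ZMod 2 => ∀ I ∈ S, f I = 0).card := by
    refine Finset.card_bijective anf (anf_bijective r) ?_
    simp
  rw [h, eq_div_iff (by positivity)]
  have := card_vanishing_mul_two_pow S
  rw [Fintype.card_finset, Fintype.card_fin] at this
  exact_mod_cast this

theorem card_le_algDeg {r : ℕ} {B : (Fin r → ZMod 2) → ZMod 2} {I : Finset (Fin r)}
    (h : anf B I ≠ 0) : I.card ≤ algDeg B :=
  Finset.le_sup (f := Finset.card) (by simpa using h)

/-- The subsets of `Fin r` with at most one missing element. -/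
def nearTop (r : ℕ) : Finset (Finset (Fin r)) :=
  insert Finset.univ (Finset.univ.image fun i => Finset.univ.erase i)

theorem card_nearTop (r : ℕ) : (nearTop r).card = r + 1 := by
  unfold nearTop
  rw [Finset.card_insert_of_notMem, Finset.card_image_of_injective]
  · simp
  · intro i j h
    by_contra hij
    have : i ∈ (Finset.univ : Finset (Fin r)).erase j := by simp [hij]
    rw [← show Finset.univ.erase i = Finset.univ.erase j from h] at this
    simp at this
  · simp

theorem le_card_of_mem_nearTop {r : ℕ} {I : Finset (Fin r)} (h : I ∈ nearTop r) :
    r - 1 ≤ I.card := by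
  simp only [nearTop, Finset.mem_insert, Finset.mem_image, Finset.mem_univ, true_and] at h
  obtain rfl | ⟨i, rfl⟩ := h <;> simp

theorem le_algDeg_s8 {r : ℕ} (hr : 1 ≤ r) (B : (Fin r → ZMod 2) → ZMod 2) :
    (r : ℚ) - (if ∀ I ∈ ({Finset.univ} : Finset (Finset (Fin r))), anf B I = 0 then 1 else 0)
      - ((r : ℚ) - 1) * (if ∀ I ∈ nearTop r, anf B I = 0 then 1 else 0) ≤ algDeg B := by
  have hr' : (1 : ℚ) ≤ r := by exact_mod_cast hr
  by_cases h1 : anf B Finset.univ = 0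
  · by_cases h2 : ∀ I ∈ nearTop r, anf B I = 0
    · simp [h1, if_pos h2]
    · rw [if_neg h2]
      push Not at h2
      obtain ⟨I, hI, hB⟩ := h2
      have h3 : r ≤ algDeg B + 1 := by
        have := le_card_of_mem_nearTop hI
        have := card_le_algDeg hB
        omega
      have h4 : (r : ℚ) ≤ algDeg B + 1 := by exact_mod_cast h3
      simp [h1]
      linarith
  · have h2 : ¬ ∀ I ∈ nearTop r, anf B I = 0 := fun h =>
      h1 (h _ (by simp [nearTop]))
    have h3 := card_le_algDeg h1
    rw [if_neg h2]
    simpa [h1] using h3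

theorem four_mul_pred_le_two_pow (r : ℕ) : 4 * r ≤ 2 ^ r + 4 := by
  induction r with
  | zero => simp
  | succ n ih =>
    rcases Nat.lt_or_ge n 2 with h | h
    · interval_cases n <;> simp
    · have : 2 ^ 2 ≤ 2 ^ n := Nat.pow_le_pow_right (by norm_num) h
      rw [pow_succ]
      omega

theorem stmt8 (r : ℕ) (hr : 1 ≤ r) :
    (r : ℚ) - 1 / 2 - ((r : ℚ) - 1) / 2 ^ (r + 1)
        ≤ (∑ B : (Fin r → ZMod 2) → ZMod 2, (algDeg B : ℚ)) / 2 ^ (2 ^ r) ∧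
      (r : ℚ) - 5 / 8 ≤ (r : ℚ) - 1 / 2 - ((r : ℚ) - 1) / 2 ^ (r + 1) := by
  constructor
  · have hsum := Finset.sum_le_sum fun B (_ : B ∈ Finset.univ) => le_algDeg_s8 hr B
    rw [Finset.sum_sub_distrib, Finset.sum_sub_distrib, ← Finset.mul_sum, Finset.sum_boole,
      Finset.sum_boole, card_anf_vanishing, card_anf_vanishing, card_nearTop] at hsum
    rw [le_div_iff₀ (by positivity)]
    refine le_trans (le_of_eq ?_) hsum
    simp [ZMod.card]
    ring
  · have h : (4 : ℚ) * r ≤ 2 ^ r + 4 := by exact_mod_cast four_mul_pred_le_two_pow r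
    have h2 : ((r : ℚ) - 1) / 2 ^ (r + 1) ≤ 1 / 8 := by
      rw [div_le_div_iff₀ (by positivity) (by norm_num), pow_succ]
      linarith
    linarith
end

section
/- Let U = (u_n)_{n=1}^∞ be a sequence of integers with u_1 ≤ 0 and u_n ≤ u_{n-1} + 1 for all n ≥ 2. If a binary sequence S over 𝔽₂ satisfies L(S,N) ≥ u_N for all N ≥ 2, then L(S,N) ≤ N - u_{N-1} for all N ≥ 2. -/
open scoped BigOperators

/-- The sequence `(s_n)` passes the `S`-dimensional `N`-lattice test if the vectors
`(s_n - s_1, s_{n+1} - s_2, …, s_{n+S-1} - s_S)`, `n = 2, 3, …, N - S + 1`,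
span `𝔽₂^S`. -/
def passesLatticeTest (s : ℕ → ZMod 2) (N S : ℕ) : Prop :=
  Submodule.span (ZMod 2)
      {v : Fin S → ZMod 2 |
        ∃ n : ℕ, 2 ≤ n ∧ n ≤ N - S + 1 ∧
          v = fun i : Fin S => s (n + (i : ℕ)) - s (1 + (i : ℕ))} = ⊤

/-- The `N`th lattice level: the greatest positive `S` such that the sequence passes the
`S`-dimensional `N`-lattice test (and `0` if there is no such `S`). -/
noncomputable def latticeLevel (s : ℕ → ZMod 2) (N : ℕ) : ℕ :=
  sSup {S : ℕ | 0 < S ∧ passesLatticeTest s N S}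

/-- The `N`th linear complexity: the smallest `L` such that
`s_{n+L} = c_{L-1} s_{n+L-1} + … + c_0 s_n` for `n = 1, …, N - L` and some fixed
`c_0, …, c_{L-1} ∈ 𝔽₂`.  (The conventions `L = 0` for the zero segment and `L = N` for
`s_1 = … = s_{N-1} = 0`, `s_N = 1` are automatic: for `L = 0` the condition reads
`s_n = 0` for `1 ≤ n ≤ N`, and for `L = N` it is vacuous.) -/
noncomputable def linComplexity (s : ℕ → ZMod 2) (N : ℕ) : ℕ :=
  sInf {L : ℕ | ∃ c : Fin L → ZMod 2,
    ∀ n : ℕ, 1 ≤ n → n + L ≤ N → s (n + L) = ∑ i : Fin L, c i * s (n + (i : ℕ))}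

open Polynomial

/-- The linear functional on `𝔽₂[X]` sending `X ^ i` to `s (i + 1)`. -/
noncomputable def seqFunctional (s : ℕ → ZMod 2) : (ZMod 2)[X] →ₗ[ZMod 2] ZMod 2 :=
  Polynomial.lsum fun i => LinearMap.toSpanSingleton (ZMod 2) (ZMod 2) (s (i + 1))

lemma seqFunctional_X_pow (s : ℕ → ZMod 2) (n : ℕ) : seqFunctional s (X ^ n) = s (n + 1) := by
  simp [seqFunctional, Polynomial.lsum_apply, ← Polynomial.monomial_one_right_eq_X_pow,
    Polynomial.sum_monomial_index]

lemma seqFunctional_mul (s : ℕ → ZMod 2) {p : (ZMod 2)[X]} {D : ℕ} (hp : p.natDegree < D)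
    (q : (ZMod 2)[X]) :
    seqFunctional s (p * q) = ∑ i ∈ Finset.range D, p.coeff i * seqFunctional s (X ^ i * q) := by
  conv_lhs => rw [p.as_sum_range' D hp]
  rw [Finset.sum_mul, map_sum]
  refine Finset.sum_congr rfl fun i _ => ?_
  rw [← Polynomial.C_mul_X_pow_eq_monomial, mul_assoc, ← Polynomial.smul_eq_C_mul, map_smul,
    smul_eq_mul]

/-- `f` is the characteristic polynomial of a linear recurrence of order `L` satisfied by
`s 1, …, s N`. -/
def IsCharPoly (s : ℕ → ZMod 2) (N L : ℕ) (f : (ZMod 2)[X]) : Prop :=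
  f.Monic ∧ f.natDegree = L ∧ ∀ n, n + L < N → seqFunctional s (X ^ n * f) = 0

lemma seqFunctional_X_pow_mul {s : ℕ → ZMod 2} {L : ℕ} {f : (ZMod 2)[X]}
    (hf : f.Monic) (hd : f.natDegree = L) (n : ℕ) :
    seqFunctional s (X ^ n * f) =
      (∑ i : Fin L, f.coeff i * s (n + 1 + (i : ℕ))) + s (n + 1 + L) := by
  have hc : f.coeff L = 1 := by rw [← hd]; exact hf
  rw [mul_comm, seqFunctional_mul s (show f.natDegree < L + 1 by omega), Finset.sum_range_succ, hc,
    one_mul, Finset.sum_range]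
  simp only [← pow_add, seqFunctional_X_pow]
  congr 1
  · refine Finset.sum_congr rfl fun i _ => ?_
    congr 2; omega
  · congr 1; omega

lemma exists_recurrence_iff_exists_isCharPoly (s : ℕ → ZMod 2) (N L : ℕ) :
    (∃ c : Fin L → ZMod 2,
      ∀ n : ℕ, 1 ≤ n → n + L ≤ N → s (n + L) = ∑ i : Fin L, c i * s (n + (i : ℕ))) ↔
    ∃ f, IsCharPoly s N L f := by
  constructor
  · rintro ⟨c, hc⟩
    set r : (ZMod 2)[X] := ∑ i : Fin L, C (c i) * X ^ (i : ℕ) with hr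
    have hdeg : r.degree < (L : WithBot ℕ) := Polynomial.degree_sum_fin_lt c
    have hm : (X ^ L + r).Monic := Polynomial.monic_X_pow_add hdeg
    have hd : (X ^ L + r).natDegree = L := by
      rw [Polynomial.natDegree_add_eq_left_of_degree_lt]
      · simp
      · simpa using hdeg
    refine ⟨X ^ L + r, hm, hd, fun n hn => ?_⟩
    rw [seqFunctional_X_pow_mul hm hd, hc (n + 1) (by omega) (by omega),
      ← Finset.sum_add_distrib]
    refine Finset.sum_eq_zero fun i _ => ?_
    have : (X ^ L + r).coeff (i : ℕ) = c i := by
      simp [hr, Polynomial.coeff_X_pow, i.2.ne, Fin.val_inj]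
    rw [this, CharTwo.add_self_eq_zero]
  · rintro ⟨f, hm, hd, hf⟩
    refine ⟨fun i => f.coeff i, fun n h1 hn => ?_⟩
    obtain ⟨n, rfl⟩ := Nat.exists_eq_add_of_le' h1
    have := hf n (by omega)
    rw [seqFunctional_X_pow_mul hm hd] at this
    exact (CharTwo.add_eq_zero.mp this).symm

/-- The invariant of the Berlekamp–Massey algorithm: `f` generates `s 1, …, s N`, and `g`
certifies that no recurrence of order less than `L` does. -/
def BerlekampMasseyInvariant (s : ℕ → ZMod 2) (N L : ℕ) (f g : (ZMod 2)[X]) : Prop :=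
  IsCharPoly s N L f ∧ g.natDegree + L ≤ N ∧
    (∀ n, n + 1 < L → seqFunctional s (X ^ n * g) = 0) ∧
    (∀ n, n + 1 = L → seqFunctional s (X ^ n * g) = 1) ∧ (L = 0 → g = 0)

lemma BerlekampMasseyInvariant.linComplexity_eq {s : ℕ → ZMod 2} {N L : ℕ} {f g : (ZMod 2)[X]}
    (h : BerlekampMasseyInvariant s N L f g) : linComplexity s N = L := by
  obtain ⟨hf, hgd, hg0, hg1, -⟩ := h
  simp only [linComplexity, exists_recurrence_iff_exists_isCharPoly]
  refine le_antisymm (Nat.sInf_le ⟨f, hf⟩) (le_csInf ⟨L, f, hf⟩ ?_)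
  rintro L' ⟨f', hm, hd, hf'⟩
  by_contra! hlt
  have hc : f'.coeff L' = 1 := by rw [← hd]; exact hm
  have h1 : seqFunctional s (f' * (X ^ (L - 1 - L') * g)) = 1 := by
    rw [seqFunctional_mul s (show f'.natDegree < L' + 1 by omega), Finset.sum_range_succ, hc,
      Finset.sum_eq_zero, zero_add, one_mul, ← mul_assoc, ← pow_add, hg1 _ (by omega)]
    intro i hi
    rw [Finset.mem_range] at hi
    rw [← mul_assoc (X ^ i), ← pow_add, hg0 _ (by omega), mul_zero]
  have hdeg : (X ^ (L - 1 - L') * g).natDegree < N - L' := by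
    have := Polynomial.natDegree_mul_le (p := X ^ (L - 1 - L')) (q := g)
    rw [Polynomial.natDegree_X_pow] at this
    omega
  rw [mul_comm, seqFunctional_mul s hdeg, Finset.sum_eq_zero] at h1
  · exact zero_ne_one h1
  · intro i hi
    rw [Finset.mem_range] at hi
    rw [hf' i (by omega), mul_zero]

lemma Polynomial.Monic.monic_add_and_natDegree_add_of_natDegree_lt {f r : (ZMod 2)[X]} (hf : f.Monic)
    (h : r.natDegree < f.natDegree) : (f + r).Monic ∧ (f + r).natDegree = f.natDegree :=
  ⟨hf.add_of_left (Polynomial.degree_lt_degree h),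
    Polynomial.natDegree_add_eq_left_of_natDegree_lt h⟩

lemma BerlekampMasseyInvariant.step {s : ℕ → ZMod 2} {N L : ℕ} {f g : (ZMod 2)[X]}
    (h : BerlekampMasseyInvariant s N L f g) :
    (∃ f' g', BerlekampMasseyInvariant s (N + 1) L f' g') ∨
      ∃ f' g', BerlekampMasseyInvariant s (N + 1) (N + 1 - L) f' g' := by
  obtain ⟨⟨hm, hd, hf⟩, hgd, hg0, hg1, hgz⟩ := h
  have hdisc : seqFunctional s (X ^ (N - L) * f) = 0 ∨ seqFunctional s (X ^ (N - L) * f) = 1 := by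
    generalize seqFunctional s (X ^ (N - L) * f) = d
    revert d; decide
  rcases hdisc with h0 | h1
  · refine Or.inl ⟨f, g, ⟨hm, hd, fun n hn => ?_⟩, by omega, hg0, hg1, hgz⟩
    rcases Nat.lt_or_ge (n + L) N with hlt | hge
    · exact hf n hlt
    · rwa [show n = N - L by omega]
  rcases Nat.lt_or_ge N (2 * L) with hNL | hNL
  · left
    have hdeg : (X ^ (2 * L - 1 - N) * g).natDegree < f.natDegree := by
      have := Polynomial.natDegree_mul_le (p := X ^ (2 * L - 1 - N)) (q := g)
      rw [Polynomial.natDegree_X_pow] at this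
      omega
    obtain ⟨hm', hd'⟩ := hm.monic_add_and_natDegree_add_of_natDegree_lt hdeg
    refine ⟨_, g, ⟨hm', hd'.trans hd, fun n hn => ?_⟩, by omega, hg0, hg1, hgz⟩
    rw [mul_add, map_add, ← mul_assoc, ← pow_add]
    rcases Nat.lt_or_ge (n + L) N with hlt | hge
    · rw [hf n hlt, hg0 _ (by omega), add_zero]
    · rw [show n = N - L by omega, h1, hg1 _ (by omega), CharTwo.add_self_eq_zero]
  · right
    have hm₁ : (X ^ (N + 1 - 2 * L) * f).Monic := (Polynomial.monic_X_pow _).mul hm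
    have hd₁ : (X ^ (N + 1 - 2 * L) * f).natDegree = N + 1 - L := by
      rw [(Polynomial.monic_X_pow _).natDegree_mul hm, Polynomial.natDegree_X_pow]
      omega
    obtain ⟨hm', hd'⟩ := hm₁.monic_add_and_natDegree_add_of_natDegree_lt (r := g) (by omega)
    refine ⟨_, f, ⟨hm', hd'.trans hd₁, fun n hn => ?_⟩, by omega, fun n hn => hf n (by omega),
      fun n hn => ?_, fun h => by omega⟩
    · rw [mul_add, map_add, ← mul_assoc, ← pow_add]
      rcases Nat.lt_or_ge (n + 1) L with hlt | hge
      · rw [hf _ (by omega), hg0 n hlt, add_zero]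
      · rw [show n + (N + 1 - 2 * L) = N - L by omega, h1, hg1 n (by omega),
          CharTwo.add_self_eq_zero]
    · rwa [show n = N - L by omega]

lemma exists_berlekampMasseyInvariant (s : ℕ → ZMod 2) (N : ℕ) :
    ∃ f g, BerlekampMasseyInvariant s N (linComplexity s N) f g := by
  induction N with
  | zero =>
    have h : BerlekampMasseyInvariant s 0 0 1 0 := by
      simp [BerlekampMasseyInvariant, IsCharPoly]
    rw [h.linComplexity_eq]
    exact ⟨1, 0, h⟩
  | succ N ih =>
    obtain ⟨f, g, h⟩ := ih
    rcases h.step with ⟨f', g', h'⟩ | ⟨f', g', h'⟩ <;>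
    · rw [h'.linComplexity_eq]
      exact ⟨f', g', h'⟩

lemma linComplexity_le (s : ℕ → ZMod 2) (N : ℕ) : linComplexity s N ≤ N := by
  obtain ⟨f, g, -, h, -⟩ := exists_berlekampMasseyInvariant s N
  omega

lemma linComplexity_succ_eq_or (s : ℕ → ZMod 2) (N : ℕ) :
    linComplexity s (N + 1) = linComplexity s N ∨
      linComplexity s (N + 1) = N + 1 - linComplexity s N := by
  obtain ⟨f, g, h⟩ := exists_berlekampMasseyInvariant s N
  exact h.step.imp (fun ⟨_, _, h'⟩ => h'.linComplexity_eq) fun ⟨_, _, h'⟩ => h'.linComplexity_eq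

theorem stmt12 (u : ℕ → ℤ) (hu1 : u 1 ≤ 0)
    (hu : ∀ n : ℕ, 2 ≤ n → u n ≤ u (n - 1) + 1)
    (s : ℕ → ZMod 2)
    (hL : ∀ N : ℕ, 2 ≤ N → u N ≤ (linComplexity s N : ℤ)) :
    ∀ N : ℕ, 2 ≤ N → (linComplexity s N : ℤ) ≤ (N : ℤ) - u (N - 1) := by
  intro N hN
  induction N, hN using Nat.le_induction with
  | base =>
    have := linComplexity_le s 2
    norm_num
    omega
  | succ N hN ih =>
    have hle := linComplexity_le s N
    have hLN := hL N hN
    have huN := hu N hN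
    rw [Nat.add_sub_cancel]
    rcases linComplexity_succ_eq_or s N with h | h <;> omega
end

section
/- Let S = (s_n)_{n=1}^∞ be the binary sequence over 𝔽₂ defined by the integer Liouville function via λ(n) = (-1)^{s_n} for n ≥ 1. Then ⌊N/2⌋ ≤ L(S,N) ≤ ⌊N/2⌋ + 1 for all N ≥ 1. -/
open scoped BigOperators

/-- The Liouville function `λ(n) = (-1)^{Ω(n)}`, where `Ω(n)` is the number of prime
factors of `n` counted with multiplicity. -/
def liouville (n : ℕ) : ℤ := (-1) ^ (ArithmeticFunction.cardFactors n)

open Polynomial in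
/-- The only polynomial solutions over `𝔽₂` of the homogenized Riccati equation have `B = 0`. -/
theorem one_add_X_pow_dvd_of_riccati (n : ℕ) : ∀ B R : (ZMod 2)[X],
    (1 + X) ^ 2 * (derivative (X * (B * R)) + R ^ 2) = X ^ 2 * B ^ 2 → (1 + X) ^ n ∣ B := by
  have two : (2 : (ZMod 2)[X]) = 0 := CharTwo.two_eq_zero
  have root : ∀ P : (ZMod 2)[X], P.eval 1 = 0 → (1 + X) ∣ P := fun P hP => by
    have := dvd_iff_isRoot.mpr hP
    rwa [map_one, CharTwo.sub_eq_add, add_comm] at this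
  have ne : (1 + X : (ZMod 2)[X]) ≠ 0 := fun h => by
    have := congrArg (eval 0) h
    simp at this
  induction n with
  | zero => intro B R _; simp
  | succ n ih =>
    intro B R h
    obtain ⟨C, rfl⟩ : (1 + X) ∣ B := root B <| by
      have := congrArg (eval 1) h
      simp only [eval_mul, eval_pow, eval_add, eval_one, eval_X, CharTwo.add_self_eq_zero] at this
      simpa using this.symm
    have h1 : C * R + X * (1 + X) * derivative (C * R) + R ^ 2 = X ^ 2 * C ^ 2 := by
      apply mul_left_cancel₀ (pow_ne_zero 2 ne)
      rw [show X * ((1 + X) * C * R) = X * ((1 + X) * (C * R)) by ring, derivative_mul,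
        derivative_mul] at h
      simp only [derivative_X, derivative_add, derivative_one] at h
      linear_combination h - (1 + X) ^ 2 * (X * (C * R)) * two
    obtain ⟨Q, rfl⟩ : (1 + X) ∣ R := root R <| by
      have := congrArg (eval 1) h1
      simp only [eval_mul, eval_pow, eval_add, eval_one, eval_X, CharTwo.add_self_eq_zero,
        mul_zero, zero_mul, add_zero] at this
      generalize eval 1 C = c at this
      generalize eval 1 R = r at this ⊢
      revert c r
      decide
    rw [pow_succ']
    refine mul_dvd_mul_left _ (ih C Q ?_)
    rw [show C * ((1 + X) * Q) = (1 + X) * (C * Q) by ring, derivative_mul] at h1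
    simp only [derivative_X, derivative_add, derivative_one] at h1
    rw [derivative_mul, derivative_X]
    linear_combination h1

open Polynomial in
theorem eq_zero_of_riccati {B R : (ZMod 2)[X]}
    (h : (1 + X) ^ 2 * (derivative (X * (B * R)) + R ^ 2) = X ^ 2 * B ^ 2) : B = 0 := by
  have hdeg : (1 + X : (ZMod 2)[X]).natDegree = 1 := by
    rw [add_comm, ← C_1]; exact natDegree_X_add_C 1
  refine eq_zero_of_dvd_of_natDegree_lt
    (one_add_X_pow_dvd_of_riccati (B.natDegree + 1) B R h) ?_
  rw [natDegree_pow, hdeg]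
  omega

open Polynomial in
/-- A truncated generating series of a sequence with `t (2 n) = t n + 1` satisfies a Riccati
equation over `𝔽₂`. -/
theorem X_pow_dvd_riccati {t : ℕ → ZMod 2} (ht : ∀ n, 1 ≤ n → t (2 * n) = t n + 1) {K : ℕ}
    {F : (ZMod 2)[X]} (hF0 : F.coeff 0 = 0) (hF : ∀ n, 1 ≤ n → n < K → F.coeff n = t n) :
    X ^ K ∣ (1 + X) ^ 2 * (derivative (X * F) + F ^ 2) - X ^ 2 := by
  have two : (2 : (ZMod 2)[X]) = 0 := CharTwo.two_eq_zero
  have hco : ∀ n, n < K → (derivative (X * F) + F ^ 2).coeff n =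
      if 2 ∣ n ∧ n ≠ 0 then 1 else 0 := by
    intro n hn
    rw [coeff_add, coeff_derivative, coeff_X_mul, ← ZMod.expand_card, coeff_expand two_pos]
    by_cases h2 : 2 ∣ n
    · obtain ⟨m, rfl⟩ := h2
      have e : (2 : ZMod 2) = 0 := rfl
      rcases Nat.eq_zero_or_pos m with rfl | hm
      · simp [hF0]
      · rw [if_pos (dvd_mul_right _ _), if_pos ⟨dvd_mul_right _ _, by omega⟩,
          Nat.mul_div_cancel_left _ two_pos, hF _ (by omega) hn, hF m hm (by omega), ht m hm]
        push_cast
        linear_combination (t m * m + m + t m) * e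
    · rw [if_neg h2, if_neg (fun h => h2 h.1)]
      have : ((n : ZMod 2) + 1) = 0 := by
        have : 2 ∣ n + 1 := by omega
        exact_mod_cast (ZMod.natCast_eq_zero_iff _ _).mpr this
      simp [this]
  rw [show (1 + X : (ZMod 2)[X]) ^ 2 = 1 + X ^ 2 by linear_combination X * two, X_pow_dvd_iff]
  intro n hn
  rw [coeff_sub, add_mul, one_mul, coeff_add, hco n hn, coeff_X_pow_mul', coeff_X_pow]
  by_cases h2 : 2 ≤ n
  · rw [if_pos h2, hco _ (by omega)]
    have e : (1 + 1 : ZMod 2) = 0 := rfl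
    split_ifs <;> first | omega | simp [e]
  · rw [if_neg h2, if_neg (by omega), if_neg (by omega)]
    simp

open Polynomial in
/-- The Hankel rows of a sequence with `t (2 n) = t n + 1` are linearly independent, as soon as
there is one more column than rows. -/
theorem eq_zero_of_hankel_eq_zero {t : ℕ → ZMod 2} (ht : ∀ n, 1 ≤ n → t (2 * n) = t n + 1)
    (d : ℕ) (a : ℕ → ZMod 2)
    (h : ∀ n, 1 ≤ n → n ≤ d + 2 → ∑ i ∈ Finset.range (d + 1), a i * t (n + i) = 0) :
    ∀ i ≤ d, a i = 0 := by
  set K := 2 * d + 3 with hK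
  have two : (2 : (ZMod 2)[X]) = 0 := CharTwo.two_eq_zero
  set F : (ZMod 2)[X] := ∑ n ∈ Finset.range K, monomial n (if n = 0 then 0 else t n) with hFdef
  have hFc : ∀ n < K, F.coeff n = if n = 0 then 0 else t n := by
    intro n hn
    simp only [hFdef, finsetSum_coeff, coeff_monomial]
    rw [Finset.sum_ite_eq' (Finset.range K) n, if_pos (Finset.mem_range.mpr hn)]
  set B : (ZMod 2)[X] := ∑ i ∈ Finset.range (d + 1), monomial (d - i) (a i) with hBdef
  have hBdeg : B.natDegree ≤ d := natDegree_sum_le_of_forall_le _ _ fun i _ =>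
    (natDegree_monomial_le _).trans (Nat.sub_le _ _)
  set R : (ZMod 2)[X] := ∑ j ∈ Finset.range (d + 1), monomial j ((B * F).coeff j) with hRdef
  have hRdeg : R.natDegree ≤ d := natDegree_sum_le_of_forall_le _ _ fun j hj =>
    (natDegree_monomial_le _).trans (Finset.mem_range_succ_iff.mp hj)
  have hBF : X ^ K ∣ B * F - R := by
    rw [X_pow_dvd_iff]
    intro j hj
    have hRj : R.coeff j = if j ∈ Finset.range (d + 1) then (B * F).coeff j else 0 := by
      simp only [hRdef, finsetSum_coeff, coeff_monomial]
      rw [Finset.sum_ite_eq' (Finset.range (d + 1)) j]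
    rw [coeff_sub, hRj]
    split_ifs with hjd
    · exact sub_self _
    · rw [Finset.mem_range] at hjd
      obtain ⟨n, rfl⟩ : ∃ n, j = d + n := ⟨j - d, by omega⟩
      rw [sub_zero, hBdef, Finset.sum_mul, finsetSum_coeff, ← h n (by omega) (by omega)]
      refine Finset.sum_congr rfl fun i hi => ?_
      rw [Finset.mem_range] at hi
      rw [show d + n = (n + i) + (d - i) by omega, coeff_monomial_mul, hFc _ (by omega),
        if_neg (by omega)]
  obtain ⟨E, hE⟩ := hBF
  obtain ⟨G, hG⟩ := X_pow_dvd_riccati ht (K := K) (F := F)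
    (by rw [hFc 0 (by omega)]; simp)
    (fun n h1 hn => by rw [hFc n hn, if_neg (by omega)])
  have hB : B = 0 := by
    refine eq_zero_of_riccati (R := R) (sub_eq_zero.mp ?_)
    refine eq_zero_of_dvd_of_natDegree_lt (p := X ^ K) ?_ ?_
    · have hR : R = B * F - X ^ K * E := by rw [← hE]; ring
      have h1 : derivative (X * (B * R)) =
          B ^ 2 * derivative (X * F) - X ^ K * (derivative (X * (B * E)) + (K : (ZMod 2)[X]) * (B * E)) := by
        rw [hR, show X * (B * (B * F - X ^ K * E)) =
          B ^ 2 * (X * F) - X ^ K * (X * (B * E)) by ring, derivative_sub,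
          derivative_mul, derivative_mul (f := X ^ K), derivative_pow, derivative_X_pow]
        have : (X : (ZMod 2)[X]) ^ K = X ^ (K - 1) * X := by
          rw [← pow_succ, show K - 1 + 1 = K by omega]
        rw [this]
        simp only [map_natCast, Nat.cast_ofNat, map_ofNat]
        linear_combination (B * derivative B * (X * F)) * two
      rw [h1, hR]
      exact ⟨B ^ 2 * G - (1 + X) ^ 2 * (derivative (X * (B * E)) + (K : (ZMod 2)[X]) * (B * E) +
        2 * B * F * E - X ^ K * E ^ 2), by linear_combination B ^ 2 * hG⟩
    · rw [natDegree_X_pow]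
      have hX : (1 + X : (ZMod 2)[X]).natDegree ≤ 1 := by compute_degree
      have h1 : ((1 + X : (ZMod 2)[X]) ^ 2).natDegree ≤ 2 := natDegree_pow_le_of_le 2 hX
      have h2 : (X * (B * R)).natDegree ≤ 1 + (d + d) :=
        natDegree_mul_le_of_le natDegree_X_le (natDegree_mul_le_of_le hBdeg hRdeg)
      have h3 := natDegree_derivative_le (X * (B * R))
      have h4 : (R ^ 2).natDegree ≤ 2 * d := natDegree_pow_le_of_le 2 hRdeg
      have h5 : (B ^ 2).natDegree ≤ 2 * d := natDegree_pow_le_of_le 2 hBdeg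
      have h6 : (derivative (X * (B * R)) + R ^ 2).natDegree ≤ 2 * d :=
        natDegree_add_le_of_degree_le (by omega) h4
      have h7 := natDegree_mul_le_of_le h1 h6
      have h8 : (X ^ 2 * B ^ 2).natDegree ≤ 2 + 2 * d :=
        natDegree_mul_le_of_le (natDegree_X_pow_le 2) h5
      exact (natDegree_sub_le_of_le h7 h8).trans_lt (by simp; omega)
  intro i hi
  have hc : B.coeff (d - i) = a i := by
    rw [hBdef, finsetSum_coeff, Finset.sum_eq_single_of_mem i (Finset.mem_range_succ_iff.mpr hi)]
    · exact coeff_monomial_same _ _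
    · intro j hj hji
      rw [Finset.mem_range] at hj
      exact coeff_monomial_of_ne _ (by omega)
  rw [← hc, hB, coeff_zero]

/-- A sequence with `t (2 n) = t n + 1` satisfies on its first `2 k + 1` terms a linear
recurrence of order `k + 1`. -/
theorem exists_recurrence {t : ℕ → ZMod 2} (ht : ∀ n, 1 ≤ n → t (2 * n) = t n + 1) (k : ℕ) :
    ∃ c : Fin (k + 1) → ZMod 2, ∀ n, 1 ≤ n → n ≤ k →
      t (n + (k + 1)) = ∑ i : Fin (k + 1), c i * t (n + (i : ℕ)) := by
  let H : Matrix (Fin k) (Fin (k + 1)) (ZMod 2) := fun n i => t ((n : ℕ) + 1 + i)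
  have hrow : LinearIndependent (ZMod 2) H.row := by
    rw [Fintype.linearIndependent_iff]
    intro g hg
    rcases k with _ | d
    · exact fun i => i.elim0
    have := eq_zero_of_hankel_eq_zero ht d (fun i => if hi : i < d + 1 then g ⟨i, hi⟩ else 0) ?_
    · intro i
      have hi := this i (Nat.lt_succ_iff.mp i.2)
      rwa [dif_pos i.2] at hi
    · intro n h1 hn
      have e := congrFun hg ⟨n - 1, by omega⟩
      rw [← Fin.sum_univ_eq_sum_range
        (fun i => (if hi : i < d + 1 then g ⟨i, hi⟩ else 0) * t (n + i))]
      simp only [Finset.sum_apply, Pi.smul_apply, smul_eq_mul, Pi.zero_apply] at e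
      rw [← e]
      refine Finset.sum_congr rfl fun i _ => ?_
      rw [dif_pos i.2]
      simp only [H, Matrix.row]
      congr 2
      omega
  have hsurj : Function.Surjective H.mulVec := by
    have hr : H.rank = k := by simpa using hrow.rank_matrix
    have : LinearMap.range H.mulVecLin = ⊤ := by
      apply Submodule.eq_top_of_finrank_eq
      rw [← Matrix.rank, hr]
      simp
    exact LinearMap.range_eq_top.mp this
  obtain ⟨c, hc⟩ := hsurj fun n => t ((n : ℕ) + 1 + (k + 1))
  refine ⟨c, fun n h1 hn => ?_⟩
  have e := congrFun hc ⟨n - 1, by omega⟩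
  simp only [Matrix.mulVec, dotProduct, H, Nat.sub_add_cancel h1] at e
  rw [← e]
  exact Finset.sum_congr rfl fun i _ => mul_comm _ _

theorem liouville_exponent_two_mul {s : ℕ → ZMod 2}
    (hs : ∀ n : ℕ, 1 ≤ n → liouville n = (-1) ^ (s n).val) (n : ℕ) (hn : 1 ≤ n) :
    s (2 * n) = s n + 1 := by
  have h1 := hs n hn
  have h2 := hs (2 * n) (by omega)
  rw [liouville, ArithmeticFunction.cardFactors_mul two_ne_zero (by omega),
    ArithmeticFunction.cardFactors_apply_prime Nat.prime_two, pow_add, ← liouville, h1] at h2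
  generalize s (2 * n) = b at h2 ⊢
  generalize s n = a at h2 ⊢
  revert a b
  decide

theorem stmt15 (s : ℕ → ZMod 2)
    (hs : ∀ n : ℕ, 1 ≤ n → liouville n = (-1) ^ (s n).val) :
    ∀ N : ℕ, 1 ≤ N →
      N / 2 ≤ linComplexity s N ∧ linComplexity s N ≤ N / 2 + 1 := by
  intro N _
  have ht := liouville_exponent_two_mul hs
  have hmem : N / 2 + 1 ∈ {L : ℕ | ∃ c : Fin L → ZMod 2,
      ∀ n : ℕ, 1 ≤ n → n + L ≤ N → s (n + L) = ∑ i : Fin L, c i * s (n + (i : ℕ))} := by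
    obtain ⟨c, hc⟩ := exists_recurrence ht (N / 2)
    exact ⟨c, fun n h1 hn => hc n h1 (by omega)⟩
  refine ⟨le_csInf ⟨_, hmem⟩ ?_, Nat.sInf_le hmem⟩
  rintro L ⟨c, hc⟩
  by_contra! hL
  have := eq_zero_of_hankel_eq_zero ht L (fun i => if hi : i < L then c ⟨i, hi⟩ else 1) ?_ L le_rfl
  · simp at this
  · intro n h1 hn
    rw [Finset.sum_range_succ, ← Fin.sum_univ_eq_sum_range
      (fun i => (if hi : i < L then c ⟨i, hi⟩ else 1) * s (n + i))]
    simp only [Fin.is_lt, dite_true, Fin.eta, lt_irrefl, dite_false, one_mul]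
    rw [← hc n h1 (by omega)]
    exact CharTwo.add_self_eq_zero _
end
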